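/- Let h be a Hessenberg function on {1,…,n}, μ a composition of n, and let w = y v_μ with y ∈ S_μ. Suppose i > j satisfy i ≤ h(j) and w(i) < w(j). Then: (1) if v_μ(i) < v_μ(j), then w τ_{ij} ∉ S_μ v_μ; and (2) if v_μ(i) > v_μ(j), then w τ_{ij} ∈ S_μ v_μ. -/

import Mathlib

open MvPolynomial Finset

/-- Partial sums of a composition: `psum μ i = μ 0 + ⋯ + μ (i-1)` (so `psum μ i = [μ]_i`). -/
def psum (μ : ℕ → ℕ) (i : ℕ) : ℕ := ∑ t ∈ Finset.range i, μ t

/-- Membership in the Young subgroup `S_μ` (0-based): `y` maps each block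
`{psum μ b, …, psum μ (b+1) - 1}` (for `b < L`) to itself. -/
def YoungC {n : ℕ} (μ : ℕ → ℕ) (L : ℕ) (y : Equiv.Perm (Fin n)) : Prop :=
  ∀ b, b < L → ∀ p : Fin n, psum μ b ≤ (p : ℕ) → (p : ℕ) < psum μ (b + 1) →
    psum μ b ≤ (y p : ℕ) ∧ (y p : ℕ) < psum μ (b + 1)

/-- `v` is the permutation `v_μ`, defined (1-based) by
`v_μ([μ']_{ℓ-i-1} + j) = [μ]_i + j` for `0 ≤ i ≤ ℓ-1`, `1 ≤ j ≤ μ_{i+1}`,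
written with 0-based indices. -/
def IsVmu {n : ℕ} (μ : ℕ → ℕ) (L : ℕ) (v : Equiv.Perm (Fin n)) : Prop :=
  ∀ i, i < L → ∀ j, j < μ i →
    ∀ (hp : psum (fun t => μ (L - 1 - t)) (L - 1 - i) + j < n) (hq : psum μ i + j < n),
      v ⟨psum (fun t => μ (L - 1 - t)) (L - 1 - i) + j, hp⟩ = ⟨psum μ i + j, hq⟩

/-- The set `N_h^-(v) = {(i,j) : j < i, v(i) < v(j), i ≤ h(j)}`. -/
def NhSet {n : ℕ} (h : Fin n → Fin n) (v : Equiv.Perm (Fin n)) : Finset (Fin n × Fin n) :=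
  Finset.univ.filter fun p => p.2 < p.1 ∧ v p.1 < v p.2 ∧ p.1 ≤ h p.2

/- The top-coset class `f_μ`:  `f_μ(w) = ∏_{(i,j) ∈ N_h^-(v_μ)} (t_{w(i)} - t_{w(j)})` if
`w ∈ S_μ v_μ`, and `f_μ(w) = 0` otherwise. -/
open Classical in
noncomputable def topClass {n : ℕ} (h : Fin n → Fin n) (μ : ℕ → ℕ) (L : ℕ)
    (vmu : Equiv.Perm (Fin n)) : Equiv.Perm (Fin n) → MvPolynomial (Fin n) ℂ :=
  fun w =>
    if ∃ y, YoungC μ L y ∧ w = y * vmu then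
      ∏ p ∈ NhSet h vmu, (X (w p.1) - X (w p.2))
    else 0

/-- The dot action `(v · f)(w) = v(f(v⁻¹ w))`. -/
noncomputable def dot {n : ℕ} (v : Equiv.Perm (Fin n))
    (f : Equiv.Perm (Fin n) → MvPolynomial (Fin n) ℂ) :
    Equiv.Perm (Fin n) → MvPolynomial (Fin n) ℂ :=
  fun w => rename (⇑v) (f (v⁻¹ * w))

/-- `v ∈ S_n^μ`, the shortest left coset representatives of `S_n / S_μ`:
`v(p) < v(p+1)` whenever `p+1` is not one of the partial sums `[μ]_b`, `b < L`. -/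
def ShortLeftC {n : ℕ} (μ : ℕ → ℕ) (L : ℕ) (v : Equiv.Perm (Fin n)) : Prop :=
  ∀ p q : Fin n, (p : ℕ) + 1 = (q : ℕ) → (∀ b, b < L → (q : ℕ) ≠ psum μ b) → v p < v q

/-- `v ∈ ^μS_n`, the shortest right coset representatives of `S_μ \ S_n`:
`v⁻¹(p) < v⁻¹(p+1)` whenever `p+1` is not one of the partial sums `[μ]_b`, `b < L`. -/
def ShortRightC {n : ℕ} (μ : ℕ → ℕ) (L : ℕ) (v : Equiv.Perm (Fin n)) : Prop :=
  ∀ p q : Fin n, (p : ℕ) + 1 = (q : ℕ) → (∀ b, b < L → (q : ℕ) ≠ psum μ b) → v⁻¹ p < v⁻¹ q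

theorem psum_succ (μ : ℕ → ℕ) (k : ℕ) : psum μ (k + 1) = psum μ k + μ k :=
  Finset.sum_range_succ μ k

theorem psum_mono (μ : ℕ → ℕ) : Monotone (psum μ) :=
  monotone_nat_of_le_succ fun k => by rw [psum_succ]; exact Nat.le_add_right _ _

theorem psum_reverse (μ : ℕ → ℕ) (L : ℕ) : psum (fun t => μ (L - 1 - t)) L = psum μ L :=
  Finset.sum_range_reflect μ L

theorem exists_block (μ : ℕ → ℕ) {L x : ℕ} (hx : x < psum μ L) :
    ∃ a < L, ∃ s < μ a, x = psum μ a + s := by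
  induction L with
  | zero => simp [_root_.psum] at hx
  | succ L ih =>
    by_cases hL : x < psum μ L
    · obtain ⟨a, ha, rest⟩ := ih hL
      exact ⟨a, ha.trans (Nat.lt_succ_self L), rest⟩
    · rw [psum_succ] at hx
      exact ⟨L, Nat.lt_succ_self L, x - psum μ L, by omega, by omega⟩

theorem block_unique (μ : ℕ → ℕ) {a b x : ℕ} (ha : psum μ a ≤ x) (ha' : x < psum μ (a + 1))
    (hb : psum μ b ≤ x) (hb' : x < psum μ (b + 1)) : a = b := by
  rcases lt_trichotomy a b with hab | hab | hab
  · have := psum_mono μ (Nat.succ_le_of_lt hab)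
    simp only [Nat.succ_eq_add_one] at this
    omega
  · exact hab
  · have := psum_mono μ (Nat.succ_le_of_lt hab)
    simp only [Nat.succ_eq_add_one] at this
    omega

theorem psum_reverse_block (μ : ℕ → ℕ) {L a : ℕ} (ha : a < L) :
    psum (fun t => μ (L - 1 - t)) (L - 1 - a) + μ a =
      psum (fun t => μ (L - 1 - t)) (L - 1 - a + 1) := by
  rw [psum_succ, show L - 1 - (L - 1 - a) = a by omega]

/-- A position and its image under `v_μ` are described by a common block index and offset. -/
theorem IsVmu.exists_coord {n : ℕ} {μ : ℕ → ℕ} {L : ℕ} (htot : psum μ L = n)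
    {v : Equiv.Perm (Fin n)} (hv : IsVmu μ L v) (i : Fin n) :
    ∃ a < L, ∃ s < μ a, (v i : ℕ) = psum μ a + s ∧
      (i : ℕ) = psum (fun t => μ (L - 1 - t)) (L - 1 - a) + s := by
  obtain ⟨a, ha, s, hs, hvi⟩ := exists_block μ ((v i).isLt.trans_eq htot.symm)
  refine ⟨a, ha, s, hs, hvi, ?_⟩
  have hle := psum_mono (fun t => μ (L - 1 - t)) (show L - 1 - a + 1 ≤ L by omega)
  rw [← psum_reverse_block μ ha, psum_reverse, htot] at hle
  have hval := hv a ha s hs (by omega) (hvi ▸ (v i).isLt)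
  have hi : i = ⟨_, _⟩ := v.injective ((Fin.ext hvi).trans hval.symm)
  exact congrArg Fin.val hi

/-- Between positions `j < i`, the block index of the image under `v_μ` weakly drops, so the images
are in increasing order exactly when they lie in different blocks. -/
theorem IsVmu.exists_blocks {n : ℕ} {μ : ℕ → ℕ} {L : ℕ} (htot : psum μ L = n)
    {v : Equiv.Perm (Fin n)} (hv : IsVmu μ L v) {i j : Fin n} (hij : j < i) :
    ∃ a < L, ∃ b < L, (psum μ a ≤ v i ∧ (v i : ℕ) < psum μ (a + 1)) ∧
      (psum μ b ≤ v j ∧ (v j : ℕ) < psum μ (b + 1)) ∧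
      (v i < v j → a ≠ b) ∧ (v j < v i → a = b) := by
  obtain ⟨a, ha, s, hs, hvi, hi⟩ := hv.exists_coord htot i
  obtain ⟨b, hb, t, ht, hvj, hj⟩ := hv.exists_coord htot j
  have hij' : (j : ℕ) < i := hij
  have hsa := psum_succ μ a
  have hsb := psum_succ μ b
  refine ⟨a, ha, b, hb, by omega, by omega, fun hlt => ?_, fun hlt => ?_⟩
  · rintro rfl
    have : (v i : ℕ) < v j := hlt
    omega
  · have hlt' : (v j : ℕ) < v i := hlt
    rcases lt_trichotomy a b with hab | hab | hab
    · have := psum_mono μ (show a + 1 ≤ b from hab)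
      omega
    · exact hab
    · have := psum_mono (fun t => μ (L - 1 - t)) (show L - 1 - a + 1 ≤ L - 1 - b by omega)
      rw [← psum_reverse_block μ ha] at this
      omega

/-- The transposition of two points in one block lies in the Young subgroup. -/
theorem YoungC.swap {n : ℕ} {μ : ℕ → ℕ} {L a : ℕ} {p q : Fin n}
    (hp : psum μ a ≤ p ∧ (p : ℕ) < psum μ (a + 1))
    (hq : psum μ a ≤ q ∧ (q : ℕ) < psum μ (a + 1)) : YoungC μ L (Equiv.swap p q) := by
  intro b _ x hx hx'
  rw [Equiv.swap_apply_def]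
  split_ifs with hxp hxq
  · subst hxp
    rwa [← block_unique μ hp.1 hp.2 hx hx']
  · subst hxq
    rwa [← block_unique μ hq.1 hq.2 hx hx']
  · exact ⟨hx, hx'⟩

theorem YoungC.mul {n : ℕ} {μ : ℕ → ℕ} {L : ℕ} {y z : Equiv.Perm (Fin n)}
    (hy : YoungC μ L y) (hz : YoungC μ L z) : YoungC μ L (y * z) := fun b hb p hp hp' =>
  hy b hb (z p) (hz b hb p hp hp').1 (hz b hb p hp hp').2

/-- Lemma 3.1 / `lemma: top-coset-edges`: for `w = y v_μ` in the top coset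
and an edge datum `i > j`, `i ≤ h(j)`, `w(i) < w(j)`:
(1) if `v_μ(i) < v_μ(j)` then `w τ_{ij}` is not in the top coset `S_μ v_μ`;
(2) if `v_μ(i) > v_μ(j)` then `w τ_{ij}` lies in the top coset `S_μ v_μ`. -/
theorem statement6 (n : ℕ) (h : Fin n → Fin n) (hmono : Monotone h) (hgrow : ∀ i, i ≤ h i)
    (μ : ℕ → ℕ) (L : ℕ) (hpos : ∀ i, i < L → 0 < μ i) (htot : psum μ L = n)
    (vmu : Equiv.Perm (Fin n)) (hvmu : IsVmu μ L vmu)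
    (y : Equiv.Perm (Fin n)) (hy : YoungC μ L y)
    (w : Equiv.Perm (Fin n)) (hw : w = y * vmu)
    (i j : Fin n) (hij : j < i) (hhij : i ≤ h j) (hwij : w i < w j) :
    (vmu i < vmu j →
      ¬ ∃ z : Equiv.Perm (Fin n), YoungC μ L z ∧ w * Equiv.swap i j = z * vmu) ∧
    (vmu j < vmu i →
      ∃ z : Equiv.Perm (Fin n), YoungC μ L z ∧ w * Equiv.swap i j = z * vmu) := by
  subst hw
  obtain ⟨a, ha, b, hb, hvi, hvj, hne, heq⟩ := hvmu.exists_blocks htot hij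
  constructor
  · rintro hlt ⟨z, hz, hzeq⟩
    have hval : z (vmu i) = y (vmu j) := by
      have := Equiv.congr_fun hzeq i
      simpa using this.symm
    have hzi := hz a ha (vmu i) hvi.1 hvi.2
    have hyj := hy b hb (vmu j) hvj.1 hvj.2
    rw [hval] at hzi
    exact hne hlt (block_unique μ hzi.1 hzi.2 hyj.1 hyj.2)
  · intro hlt
    obtain rfl := heq hlt
    exact ⟨y * Equiv.swap (vmu i) (vmu j), hy.mul (YoungC.swap hvi hvj), by
      rw [mul_assoc, mul_assoc, Equiv.mul_swap_eq_swap_mul]⟩
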